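/- Let A be a coalgebra over a field k and let X ⊆ A be a subspace. Then there exists a smallest subcoalgebra of A containing X: a subcoalgebra C with X ⊆ C such that C ⊆ D for every subcoalgebra D of A with X ⊆ D. (The minimality assertion of Proposition 3.3 of the paper.) -/

import Mathlib

open TensorProduct

/-- The image in `A ⊗[k] A` of `U ⊗[k] V` under the tensor product of the inclusion maps. -/
noncomputable def tmulSub {k A : Type*} [Field k] [AddCommGroup A] [Module k A]
    (U : Submodule k A) (V : Submodule k A) : Submodule k (A ⊗[k] A) :=
  LinearMap.range (TensorProduct.map U.subtype V.subtype)

noncomputable def sliceR {k A : Type*} [Field k] [AddCommGroup A] [Module k A]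
    (f : A →ₗ[k] k) : A ⊗[k] A →ₗ[k] A :=
  (TensorProduct.rid k A).toLinearMap ∘ₗ f.lTensor A

noncomputable def sliceL {k A : Type*} [Field k] [AddCommGroup A] [Module k A]
    (f : A →ₗ[k] k) : A ⊗[k] A →ₗ[k] A :=
  (TensorProduct.lid k A).toLinearMap ∘ₗ f.rTensor A

theorem sliceR_sep {k A : Type*} [Field k] [AddCommGroup A] [Module k A]
    (s t : A ⊗[k] A) (h : ∀ f : A →ₗ[k] k, sliceR f s = sliceR f t) : s = t := by
  classical
  let b := Module.Basis.ofVectorSpace k A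
  apply (TensorProduct.equivFinsuppOfBasisRight (M := A) b).injective
  ext i
  have := h (b.coord i)
  simpa [sliceR, TensorProduct.equivFinsuppOfBasisRight_apply] using this

theorem sliceL_sep {k A : Type*} [Field k] [AddCommGroup A] [Module k A]
    (s t : A ⊗[k] A) (h : ∀ f : A →ₗ[k] k, sliceL f s = sliceL f t) : s = t := by
  classical
  let b := Module.Basis.ofVectorSpace k A
  apply (TensorProduct.equivFinsuppOfBasisLeft (N := A) b).injective
  ext i
  have := h (b.coord i)
  simpa [sliceL, TensorProduct.equivFinsuppOfBasisLeft_apply] using this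

theorem sliceR_mem {k A : Type*} [Field k] [AddCommGroup A] [Module k A]
    (U V : Submodule k A) (f : A →ₗ[k] k) (t : A ⊗[k] A) (ht : t ∈ tmulSub U V) :
    sliceR f t ∈ U := by
  obtain ⟨z, rfl⟩ := ht
  induction z with
  | zero => simp
  | tmul x y => simpa [sliceR] using U.smul_mem _ x.2
  | add x y hx hy => rw [map_add, map_add]; exact U.add_mem hx hy

theorem sliceL_mem {k A : Type*} [Field k] [AddCommGroup A] [Module k A]
    (U V : Submodule k A) (f : A →ₗ[k] k) (t : A ⊗[k] A) (ht : t ∈ tmulSub U V) :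
    sliceL f t ∈ V := by
  obtain ⟨z, rfl⟩ := ht
  induction z with
  | zero => simp
  | tmul x y => simpa [sliceL] using V.smul_mem _ y.2
  | add x y hx hy => rw [map_add, map_add]; exact V.add_mem hx hy

theorem mem_of_slices {k A : Type*} [Field k] [AddCommGroup A] [Module k A]
    (U : Submodule k A) (t : A ⊗[k] A) (hR : ∀ f : A →ₗ[k] k, sliceR f t ∈ U)
    (hL : ∀ f : A →ₗ[k] k, sliceL f t ∈ U) : t ∈ tmulSub U U := by
  obtain ⟨p, hp⟩ := U.subtype.exists_leftInverse_of_injective U.ker_subtype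
  have hp' : ∀ x ∈ U, U.subtype (p x) = x := fun x hx =>
    congrArg U.subtype (LinearMap.congr_fun hp ⟨x, hx⟩)
  have h1 : (U.subtype ∘ₗ p).rTensor A t = t := by
    apply sliceR_sep
    intro f
    rw [← hp' _ (hR f)]
    have : sliceR f ∘ₗ (U.subtype ∘ₗ p).rTensor A = U.subtype ∘ₗ p ∘ₗ sliceR f := by
      ext x y
      simp [sliceR]
    exact LinearMap.congr_fun this t
  have h2 : (U.subtype ∘ₗ p).lTensor A t = t := by
    apply sliceL_sep
    intro f
    rw [← hp' _ (hL f)]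
    have : sliceL f ∘ₗ (U.subtype ∘ₗ p).lTensor A = U.subtype ∘ₗ p ∘ₗ sliceL f := by
      ext x y
      simp [sliceL]
    exact LinearMap.congr_fun this t
  refine ⟨TensorProduct.map p p t, ?_⟩
  have h3 : TensorProduct.map U.subtype U.subtype ∘ₗ TensorProduct.map p p =
      (U.subtype ∘ₗ p).rTensor A ∘ₗ (U.subtype ∘ₗ p).lTensor A := by
    ext x y
    simp
  have h4 := LinearMap.congr_fun h3 t
  rw [LinearMap.comp_apply, LinearMap.comp_apply, h2, h1] at h4
  exact h4

/-- The minimality assertion of Proposition 3.3: every subspace `X` of a coalgebra `A`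
is contained in a smallest subcoalgebra of `A`. -/
theorem stmt_9 {k A : Type*} [Field k] [AddCommGroup A] [Module k A] [Coalgebra k A]
    (X : Submodule k A) :
    ∃ C : Submodule k A,
      (∀ c ∈ C, Coalgebra.comul (R := k) c ∈ tmulSub C C) ∧ X ≤ C ∧
      ∀ D : Submodule k A,
        (∀ d ∈ D, Coalgebra.comul (R := k) d ∈ tmulSub D D) → X ≤ D → C ≤ D := by
  refine ⟨sInf {D | (∀ d ∈ D, Coalgebra.comul (R := k) d ∈ tmulSub D D) ∧ X ≤ D}, ?_, ?_, ?_⟩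
  · intro c hc
    rw [Submodule.mem_sInf] at hc
    apply mem_of_slices
    · intro f
      rw [Submodule.mem_sInf]
      exact fun D hD => sliceR_mem D D f _ (hD.1 c (hc D hD))
    · intro f
      rw [Submodule.mem_sInf]
      exact fun D hD => sliceL_mem D D f _ (hD.1 c (hc D hD))
  · exact le_sInf fun D hD => hD.2
  · exact fun D h1 h2 => sInf_le ⟨h1, h2⟩
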